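/- Let 1 ≤ m ≤ N−1 and assume [n]_t ≠ 0 for 1 ≤ n ≤ N−m. Then (T_{N−1} − κ_{−1})(T_{N−2} − κ_{−2})⋯(T_m − κ_{−(N−m)}) φ_{{1,…,m}} = Σ_{j=m}^{N} φ_{{1,…,m−1}∪{j}}, where the operator product is composed so that the rightmost factor (T_m − κ_{−(N−m)}) acts first; the right-hand side equals (−1)^{m−1} M(φ_{{1,…,m−1}}). -/

import Mathlib

open Finset

noncomputable def phi (K : Type*) [Field K] (E : Finset ℕ) : Finset ℕ →₀ K :=
  Finsupp.single E 1

noncomputable def Tgen {K : Type*} [Field K] (t : K) (i : ℕ) :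
    (Finset ℕ →₀ K) →ₗ[K] (Finset ℕ →₀ K) :=
  Finsupp.lift _ K _ fun E =>
    if i ∈ E then
      if i + 1 ∈ E then -(phi K E)
      else phi K (insert (i + 1) (E.erase i))
    else
      if i + 1 ∈ E then t • phi K (insert i (E.erase (i + 1))) + (t - 1) • phi K E
      else t • phi K E

def sgn (i : ℕ) (E : Finset ℕ) : ℕ := (E.filter (· < i)).card

noncomputable def Mop (K : Type*) [Field K] (N : ℕ) :
    (Finset ℕ →₀ K) →ₗ[K] (Finset ℕ →₀ K) :=
  Finsupp.lift _ K _ fun E =>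
    ∑ i ∈ (Finset.Icc 1 N) \ E, ((-1 : K) ^ sgn i E) • phi K (insert i E)

noncomputable def Dop {K : Type*} [Field K] (t : K) :
    (Finset ℕ →₀ K) →ₗ[K] (Finset ℕ →₀ K) :=
  Finsupp.lift _ K _ fun E =>
    ∑ i ∈ E, ((-1 : K) ^ sgn i E * t ^ (i - 1)) • phi K (E.erase i)

noncomputable def qint {K : Type*} [Field K] (t : K) (n : ℕ) : K :=
  ∑ i ∈ Finset.range n, t ^ i

noncomputable def kappa {K : Type*} [Field K] (t : K) (n : ℤ) : K :=
  if 0 < n then t ^ n.toNat / qint t n.toNat else -(1 / qint t (-n).toNat)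

@[simp] theorem Tgen_phi {K : Type*} [Field K] (t : K) (i : ℕ) (E : Finset ℕ) :
    Tgen t i (phi K E) =
      if i ∈ E then
        if i + 1 ∈ E then -(phi K E)
        else phi K (insert (i + 1) (E.erase i))
      else
        if i + 1 ∈ E then t • phi K (insert i (E.erase (i + 1))) + (t - 1) • phi K E
        else t • phi K E := by
  rw [Tgen, Finsupp.lift_apply, phi, Finsupp.sum_single_index, one_smul]
  · rfl
  · exact zero_smul K _

@[simp] theorem Mop_phi (K : Type*) [Field K] (N : ℕ) (E : Finset ℕ) :
    Mop K N (phi K E) =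
      ∑ i ∈ (Finset.Icc 1 N) \ E, ((-1 : K) ^ sgn i E) • phi K (insert i E) := by
  rw [Mop, Finsupp.lift_apply, phi, Finsupp.sum_single_index, one_smul]
  exact zero_smul K _

theorem qint_succ {K : Type*} [Field K] (t : K) (n : ℕ) :
    qint t (n + 1) = t * qint t n + 1 := by
  simp [qint, Finset.sum_range_succ', Finset.mul_sum, pow_succ']

theorem kappa_neg_succ {K : Type*} [Field K] (t : K) (l : ℕ) :
    kappa t (-((l : ℤ) + 1)) = -(qint t (l + 1))⁻¹ := by
  have h : (-(-((l : ℤ) + 1))).toNat = l + 1 := by omega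
  rw [kappa, if_neg (by omega), h, one_div]

theorem Tgen_phi_insert_self {K : Type*} [Field K] (t : K) {S : Finset ℕ} {i : ℕ}
    (hi : i ∉ S) (hi' : i + 1 ∉ S) :
    Tgen t i (phi K (insert i S)) = phi K (insert (i + 1) S) := by
  simp [hi, hi']

theorem Tgen_phi_insert_of_lt {K : Type*} [Field K] (t : K) {S : Finset ℕ} {i j : ℕ}
    (hi : i ∉ S) (hi' : i + 1 ∉ S) (hj : j < i) :
    Tgen t i (phi K (insert j S)) = t • phi K (insert j S) := by
  have h₁ : i ≠ j := by omega
  have h₂ : i + 1 ≠ j := by omega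
  simp [hi, hi', h₁, h₂]

/-- One factor of the product formula, applied to an intermediate vector. -/
theorem Tgen_sub_kappa_apply {K : Type*} [Field K] (t : K) {S : Finset ℕ} {m p d : ℕ}
    (hS : ∀ x ∈ S, x < m) (hmp : m ≤ p) (hd : qint t (d + 1) ≠ 0)
    (hd' : m < p → qint t (d + 2) ≠ 0) :
    ((Tgen t p : Module.End K (Finset ℕ →₀ K)) - kappa t (-((d : ℤ) + 1)) • 1)
        (phi K (insert p S) +
          (qint t (d + 2))⁻¹ • ∑ j ∈ Finset.Ico m p, phi K (insert j S)) =
      phi K (insert (p + 1) S) +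
        (qint t (d + 1))⁻¹ • ∑ j ∈ Finset.Ico m (p + 1), phi K (insert j S) := by
  have hp : p ∉ S := fun h => by have := hS _ h; omega
  have hp' : p + 1 ∉ S := fun h => by have := hS _ h; omega
  have hsum : Tgen t p (∑ j ∈ Finset.Ico m p, phi K (insert j S)) =
      t • ∑ j ∈ Finset.Ico m p, phi K (insert j S) := by
    rw [map_sum, Finset.smul_sum]
    exact Finset.sum_congr rfl fun j hj =>
      Tgen_phi_insert_of_lt t hp hp' (Finset.mem_Ico.1 hj).2
  rw [kappa_neg_succ, Finset.sum_Ico_succ_top hmp, LinearMap.sub_apply, LinearMap.smul_apply,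
    Module.End.one_apply, map_add, map_smul, hsum, Tgen_phi_insert_self t hp hp']
  rcases hmp.eq_or_lt with rfl | hlt
  · simp
  · have h := hd' hlt
    have hrec : qint t (d + 2) = t * qint t (d + 1) + 1 := qint_succ t (d + 1)
    have hcoef : (qint t (d + 2))⁻¹ * t + (qint t (d + 1))⁻¹ * (qint t (d + 2))⁻¹ =
        (qint t (d + 1))⁻¹ := by
      field_simp
      rw [hrec]
    linear_combination (norm := module) hcoef • ∑ j ∈ Finset.Ico m p, phi K (insert j S)

/-- The last `d` factors of the product formula, applied to an intermediate vector. -/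
theorem prod_Tgen_sub_kappa_apply {K : Type*} [Field K] (t : K) {S : Finset ℕ} {N m : ℕ}
    (hS : ∀ x ∈ S, x < m) (hmN : m ≤ N)
    (hreg : ∀ n : ℕ, 1 ≤ n → n ≤ N - m → qint t n ≠ 0) (d : ℕ) (hd : d ≤ N - m) :
    (((List.range d).map fun l =>
        (Tgen t (N - 1 - l) : Module.End K (Finset ℕ →₀ K))
          - kappa t (-((l : ℤ) + 1)) • 1).prod)
      (phi K (insert (N - d) S) +
        (qint t (d + 1))⁻¹ • ∑ j ∈ Finset.Ico m (N - d), phi K (insert j S)) =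
      ∑ j ∈ Finset.Icc m N, phi K (insert j S) := by
  induction d with
  | zero =>
    rw [← Finset.Ico_add_one_right_eq_Icc, Finset.sum_Ico_succ_top hmN]
    simp [qint, add_comm]
  | succ d ih =>
    obtain ⟨p, rfl⟩ : ∃ p, N = p + 1 + d := ⟨N - 1 - d, by omega⟩
    have h₁ : p + 1 + d - (d + 1) = p := by omega
    have h₂ : p + 1 + d - 1 - d = p := by omega
    have h₃ : p + 1 + d - d = p + 1 := by omega
    rw [List.range_succ, List.map_append, List.prod_append, Module.End.mul_apply,
      List.map_singleton, List.prod_singleton, h₁, h₂,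
      Tgen_sub_kappa_apply t hS (by omega) (hreg _ (by omega) (by omega))
        (fun _ => hreg _ (by omega) (by omega))]
    simpa only [h₃] using ih (by omega)

/-- The product `(T_{N−1} − κ_{−1})(T_{N−2} − κ_{−2})⋯(T_m − κ_{−(N−m)})`
(rightmost factor acting first) sends `φ_{{1,…,m}}` to
`Σ_{j=m}^{N} φ_{{1,…,m−1}∪{j}}`, which equals `(−1)^{m−1} M(φ_{{1,…,m−1}})`. -/
theorem type1_product_formula {K : Type*} [Field K] (t : K) (N m : ℕ)
    (hm1 : 1 ≤ m) (hmN : m ≤ N - 1)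
    (hreg : ∀ n : ℕ, 1 ≤ n → n ≤ N - m → qint t n ≠ 0) :
    ((((List.range (N - m)).map fun l =>
        (Tgen t (N - 1 - l) : Module.End K (Finset ℕ →₀ K))
          - kappa t (-((l : ℤ) + 1)) • 1).prod)
      (phi K (Finset.Icc 1 m))
      = ∑ j ∈ Finset.Icc m N, phi K (insert j (Finset.Icc 1 (m - 1)))) ∧
    (∑ j ∈ Finset.Icc m N, phi K (insert j (Finset.Icc 1 (m - 1)))
      = ((-1 : K) ^ (m - 1)) • Mop K N (phi K (Finset.Icc 1 (m - 1)))) := by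
  have hIcc : insert m (Finset.Icc 1 (m - 1)) = Finset.Icc 1 m := by
    ext x
    simp only [Finset.mem_insert, Finset.mem_Icc]
    omega
  constructor
  · have h := prod_Tgen_sub_kappa_apply t (S := Finset.Icc 1 (m - 1)) (N := N) (m := m)
      (fun x hx => by have := Finset.mem_Icc.1 hx; omega) (by omega) hreg (N - m) le_rfl
    rwa [show N - (N - m) = m by omega, Finset.Ico_self, Finset.sum_empty, smul_zero, add_zero,
      hIcc] at h
  · have hsdiff : Finset.Icc 1 N \ Finset.Icc 1 (m - 1) = Finset.Icc m N := by
      ext x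
      simp only [Finset.mem_sdiff, Finset.mem_Icc]
      omega
    rw [Mop_phi, hsdiff, Finset.smul_sum]
    refine Finset.sum_congr rfl fun j hj => ?_
    have hsgn : sgn j (Finset.Icc 1 (m - 1)) = m - 1 := by
      rw [sgn, Finset.filter_true_of_mem, Nat.card_Icc, Nat.add_sub_cancel]
      intro x hx
      simp only [Finset.mem_Icc] at hx hj
      omega
    rw [hsgn, smul_smul, ← mul_pow, neg_one_mul, neg_neg, one_pow, one_smul]
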